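/- arXiv:2003.07824 — 6 statements merged into one kernel-verified Lean document; each statement's English description precedes it below -/
import Mathlib

section
/- Let ν, μ > 0, α ∈ ℝ, and k, m ∈ ℝ with k ≠ 0, and set ξ(x) = k x₁ − m x₃. Define the steady Kolmogorov flow v(x) = α cos(ξ) (m, 0, k), pressure p(x) = −α ν (k² + m²) (m/k) sin(ξ), and buoyancy b(x) = α ν (k² + m²) (k + m²/k) cos(ξ). Then (v, b, p) is a time-independent solution of the non-rotating Boussinesq equations (f = 0) on ℝ³ with stratification ρ̄′ if and only if α = 0 or ρ̄′ = μ ν (k² + m²)³ / k². In particular, for stable stratification ρ̄′ < 0 only the trivial solution α = 0 is possible. -/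
noncomputable section

open Real Finset

/-- Partial derivative of a scalar field in coordinate direction `j`. -/
def pd {n : ℕ} (f : (Fin n → ℝ) → ℝ) (j : Fin n) (x : Fin n → ℝ) : ℝ :=
  fderiv ℝ f x (Pi.single j 1)

/-- Euclidean dot product on `Fin n → ℝ`. -/
def dot {n : ℕ} (a b : Fin n → ℝ) : ℝ := ∑ j, a j * b j

/-- Divergence of a vector field. -/
def vdiv {n : ℕ} (v : (Fin n → ℝ) → (Fin n → ℝ)) (x : Fin n → ℝ) : ℝ :=
  ∑ j, pd (fun y => v y j) j x

/-- Advective term `((u·∇)w) i = Σ_j u_j ∂w_i/∂x_j`. -/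
def adv {n : ℕ} (u w : (Fin n → ℝ) → (Fin n → ℝ)) (x : Fin n → ℝ) (i : Fin n) : ℝ :=
  ∑ j, u x j * pd (fun y => w y i) j x

/-- Laplacian of a scalar field. -/
def lap {n : ℕ} (f : (Fin n → ℝ) → ℝ) (x : Fin n → ℝ) : ℝ :=
  ∑ j, pd (fun y => pd f j y) j x

/-- The rotating Boussinesq equations on ℝ³ in the f-plane:
`∂t v + (v·∇)v + f e₃ × v + ∇p − b e₃ = νΔv`, `∇·v = 0`,
`∂t b + (v·∇)b − ρ' v₃ = μΔb`, for `t ≥ 0`. -/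
def IsBoussinesq (f ν μ ρ' : ℝ) (v : ℝ → (Fin 3 → ℝ) → (Fin 3 → ℝ))
    (b p : ℝ → (Fin 3 → ℝ) → ℝ) : Prop :=
  ∀ t, 0 ≤ t → ∀ x : Fin 3 → ℝ,
    (∀ i, deriv (fun s => v s x i) t + adv (v t) (v t) x i
        + f * (![-(v t x 1), v t x 0, 0] i) + pd (p t) i x - b t x * (![(0:ℝ), 0, 1] i)
        = ν * lap (fun y => v t y i) x)
    ∧ vdiv (v t) x = 0
    ∧ deriv (fun s => b s x) t + (∑ j, v t x j * pd (b t) j x) - ρ' * v t x 2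
        = μ * lap (b t) x

/-- The gradient of the phase `k x₀ - m x₂`, applied to a basis vector. -/
theorem pd_comp_phase {g : ℝ → ℝ} {g' : ℝ} (k m : ℝ) (j : Fin 3) (x : Fin 3 → ℝ)
    (hg : HasDerivAt g g' (k * x 0 - m * x 2)) :
    pd (fun y => g (k * y 0 - m * y 2)) j x = g' * (![k, 0, -m] j) := by
  have hphase : HasFDerivAt (fun y : Fin 3 → ℝ => k * y 0 - m * y 2)
      (k • ContinuousLinearMap.proj (R := ℝ) (φ := fun _ : Fin 3 => ℝ) 0
        - m • ContinuousLinearMap.proj (R := ℝ) (φ := fun _ : Fin 3 => ℝ) 2) x :=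
    ((hasFDerivAt_apply (0 : Fin 3) x).const_mul k).sub
      ((hasFDerivAt_apply (2 : Fin 3) x).const_mul m)
  have hcomp := hg.comp_hasFDerivAt x hphase
  unfold pd
  rw [show (fun y : Fin 3 → ℝ => g (k * y 0 - m * y 2))
    = g ∘ fun y => k * y 0 - m * y 2 from rfl, hcomp.fderiv]
  fin_cases j <;> simp

theorem pd_const_mul_cos_phase (c k m : ℝ) (j : Fin 3) (x : Fin 3 → ℝ) :
    pd (fun y => c * Real.cos (k * y 0 - m * y 2)) j x
      = -c * Real.sin (k * x 0 - m * x 2) * (![k, 0, -m] j) := by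
  rw [pd_comp_phase (g := fun s => c * Real.cos s) k m j x ((Real.hasDerivAt_cos _).const_mul c)]
  ring

theorem pd_const_mul_sin_phase (c k m : ℝ) (j : Fin 3) (x : Fin 3 → ℝ) :
    pd (fun y => c * Real.sin (k * y 0 - m * y 2)) j x
      = c * Real.cos (k * x 0 - m * x 2) * (![k, 0, -m] j) :=
  pd_comp_phase (g := fun s => c * Real.sin s) k m j x ((Real.hasDerivAt_sin _).const_mul c)

theorem lap_const_mul_cos_phase (c k m : ℝ) (x : Fin 3 → ℝ) :
    lap (fun y => c * Real.cos (k * y 0 - m * y 2)) x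
      = -(k ^ 2 + m ^ 2) * (c * Real.cos (k * x 0 - m * x 2)) := by
  have h (j : Fin 3) : (fun y => pd (fun z => c * Real.cos (k * z 0 - m * z 2)) j y)
      = fun y => (-c * (![k, 0, -m] j)) * Real.sin (k * y 0 - m * y 2) := by
    funext y
    rw [pd_const_mul_cos_phase]
    ring
  simp only [lap, h, pd_const_mul_sin_phase, Fin.sum_univ_three]
  simp
  ring

/-- The Boussinesq equations for the Kolmogorov flow reduce to the buoyancy equation. -/
theorem isBoussinesq_kolmogorov_iff (ν μ α k m ρ' : ℝ) (hk : k ≠ 0) :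
    IsBoussinesq 0 ν μ ρ'
        (fun _ x i => α * Real.cos (k * x 0 - m * x 2) * (![m, 0, k] i))
        (fun _ x => α * ν * (k ^ 2 + m ^ 2) * (k + m ^ 2 / k) * Real.cos (k * x 0 - m * x 2))
        (fun _ x => -α * ν * (k ^ 2 + m ^ 2) * (m / k) * Real.sin (k * x 0 - m * x 2))
      ↔ (α = 0 ∨ ρ' = μ * ν * (k ^ 2 + m ^ 2) ^ 3 / k ^ 2) := by
  have hv (i : Fin 3) : (fun y : Fin 3 → ℝ => α * Real.cos (k * y 0 - m * y 2) * (![m, 0, k] i))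
      = fun y => (α * (![m, 0, k] i)) * Real.cos (k * y 0 - m * y 2) := by
    funext y
    ring
  simp only [IsBoussinesq, adv, vdiv, hv, pd_const_mul_cos_phase, pd_const_mul_sin_phase,
    lap_const_mul_cos_phase, deriv_const, Fin.sum_univ_three]
  constructor
  · intro h
    have hb := (h 0 le_rfl 0).2.2
    simp at hb
    rw [or_iff_not_imp_left]
    intro hα
    field_simp at hb ⊢
    linear_combination -hb
  · intro h t _ x
    refine ⟨fun i => ?_, ?_, ?_⟩
    · fin_cases i <;> simp <;> field_simp <;> ring
    · simp
      ring
    · rcases h with rfl | rfl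
      · simp
      · simp
        field_simp
        ring

/-- The steady Kolmogorov flow `v = α cos(ξ)(m,0,k)`, `ξ = kx₁ − mx₃`, with
`p = −αν(k²+m²)(m/k) sin ξ` and `b = αν(k²+m²)(k+m²/k) cos ξ`, is a time-independent
solution of the non-rotating Boussinesq equations iff `α = 0` or
`ρ' = μν(k²+m²)³/k²`; in particular, for `ρ' < 0` only `α = 0` is possible. -/
theorem stmt4 (ν μ α k m ρ' : ℝ) (hν : 0 < ν) (hμ : 0 < μ) (hk : k ≠ 0) :
    (IsBoussinesq 0 ν μ ρ'
        (fun _ x i => α * Real.cos (k * x 0 - m * x 2) * (![m, 0, k] i))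
        (fun _ x => α * ν * (k ^ 2 + m ^ 2) * (k + m ^ 2 / k) * Real.cos (k * x 0 - m * x 2))
        (fun _ x => -α * ν * (k ^ 2 + m ^ 2) * (m / k) * Real.sin (k * x 0 - m * x 2))
      ↔ (α = 0 ∨ ρ' = μ * ν * (k ^ 2 + m ^ 2) ^ 3 / k ^ 2))
    ∧ (ρ' < 0 →
        IsBoussinesq 0 ν μ ρ'
          (fun _ x i => α * Real.cos (k * x 0 - m * x 2) * (![m, 0, k] i))
          (fun _ x => α * ν * (k ^ 2 + m ^ 2) * (k + m ^ 2 / k) * Real.cos (k * x 0 - m * x 2))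
          (fun _ x => -α * ν * (k ^ 2 + m ^ 2) * (m / k) * Real.sin (k * x 0 - m * x 2))
        → α = 0) := by
  refine ⟨isBoussinesq_kolmogorov_iff ν μ α k m ρ' hk, fun hρ h => ?_⟩
  refine ((isBoussinesq_kolmogorov_iff ν μ α k m ρ' hk).1 h).resolve_right fun hρ_eq => ?_
  have : 0 ≤ μ * ν * (k ^ 2 + m ^ 2) ^ 3 / k ^ 2 := by positivity
  linarith
end
end

section
/- Let f ∈ ℝ, ρ̄′ ∈ ℝ, α ∈ ℝ, k, m ∈ ℝ with k ≠ 0, and let ν > 0 with μ = ν. Suppose ω ∈ ℝ is nonzero with ω² = (−ρ̄′ k² + f² m²)/(k² + m²), and set ξ(t,x) = k x₁ − m x₃ − ω t and E(t) = exp(−ν (k² + m²) t). Then the exponentially decaying fields v(t,x) = E(t) α ( cos(ξ) (m, 0, k) + (m f / ω) sin(ξ) e₂ ), p(t,x) = E(t) α m (ω² − f²)/(k ω) cos(ξ), and b(t,x) = −E(t) α (k/ω) ρ̄′ sin(ξ) solve the viscous rotating Boussinesq equations on ℝ³ with viscosity ν and diffusivity μ = ν. -/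
noncomputable section

open Real Finset

/-- Partial derivatives of a plane wave with wave vector `(k, 0, -m)` and phase shift `c`. -/
theorem pd_plane_wave (A B k m c : ℝ) (j : Fin 3) (x : Fin 3 → ℝ) :
    pd (fun y => A * Real.cos (k * y 0 - m * y 2 - c) + B * Real.sin (k * y 0 - m * y 2 - c)) j x
      = (![k, 0, -m] j * B) * Real.cos (k * x 0 - m * x 2 - c)
        + (-(![k, 0, -m] j) * A) * Real.sin (k * x 0 - m * x 2 - c) := by
  have hcoord (i : Fin 3) : HasFDerivAt (fun y : Fin 3 → ℝ => y i)
      (ContinuousLinearMap.proj (R := ℝ) (φ := fun _ : Fin 3 => ℝ) i) x :=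
    (ContinuousLinearMap.proj (R := ℝ) (φ := fun _ : Fin 3 => ℝ) i).hasFDerivAt
  have hphase := (((hcoord 0).const_mul k).sub ((hcoord 2).const_mul m)).sub_const c
  have hwave := (hphase.cos.const_mul A).add (hphase.sin.const_mul B)
  unfold pd
  erw [hwave.fderiv]
  fin_cases j <;> simp <;> ring

/-- The Laplacian of a plane wave is the wave times `-(k ^ 2 + m ^ 2)`. -/
theorem lap_plane_wave (A B k m c : ℝ) (x : Fin 3 → ℝ) :
    lap (fun y => A * Real.cos (k * y 0 - m * y 2 - c) + B * Real.sin (k * y 0 - m * y 2 - c)) x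
      = -(k ^ 2 + m ^ 2) * (A * Real.cos (k * x 0 - m * x 2 - c)
        + B * Real.sin (k * x 0 - m * x 2 - c)) := by
  simp only [lap, pd_plane_wave, Fin.sum_univ_three]
  simp
  ring

/-- Time derivative of an exponentially damped oscillation. -/
theorem deriv_damped_wave (A B a d ω t : ℝ) :
    deriv (fun s => Real.exp (a * s) * A * Real.cos (d - ω * s)
        + Real.exp (a * s) * B * Real.sin (d - ω * s)) t
      = Real.exp (a * t) * ((a * A - ω * B) * Real.cos (d - ω * t)
        + (a * B + ω * A) * Real.sin (d - ω * t)) := by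
  have hexp := ((hasDerivAt_id t).const_mul a).exp
  have hphase := ((hasDerivAt_id t).const_mul ω).const_sub d
  have hwave := ((hexp.mul_const A).mul hphase.cos).add ((hexp.mul_const B).mul hphase.sin)
  refine hwave.deriv.trans ?_
  simp only [id]
  ring

/-- With viscosity `ν > 0` and diffusivity `μ = ν`, the exponentially decaying
monochromatic inertia–gravity wave, i.e. the fields of STATEMENT 6 multiplied by
`E(t) = exp(−ν(k²+m²)t)`, solves the viscous rotating Boussinesq equations on ℝ³. -/
theorem stmt7 (f ρ' α k m ω ν : ℝ) (hk : k ≠ 0) (hν : 0 < ν) (hω : ω ≠ 0)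
    (hdisp : ω ^ 2 = (-ρ' * k ^ 2 + f ^ 2 * m ^ 2) / (k ^ 2 + m ^ 2)) :
    IsBoussinesq f ν ν ρ'
      (fun t x i => Real.exp (-ν * (k ^ 2 + m ^ 2) * t) *
        (α * (Real.cos (k * x 0 - m * x 2 - ω * t) * (![m, 0, k] i)
           + (m * f / ω) * Real.sin (k * x 0 - m * x 2 - ω * t) * (![(0:ℝ), 1, 0] i))))
      (fun t x => Real.exp (-ν * (k ^ 2 + m ^ 2) * t) *
        (-α * (k / ω) * ρ' * Real.sin (k * x 0 - m * x 2 - ω * t)))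
      (fun t x => Real.exp (-ν * (k ^ 2 + m ^ 2) * t) *
        (α * m * (ω ^ 2 - f ^ 2) / (k * ω) * Real.cos (k * x 0 - m * x 2 - ω * t))) := by
  have hkm : k ^ 2 + m ^ 2 ≠ 0 := by positivity
  have hdisp' : ω ^ 2 * (k ^ 2 + m ^ 2) = -ρ' * k ^ 2 + f ^ 2 * m ^ 2 := by
    rw [hdisp, div_mul_cancel₀ _ hkm]
  have hv (t : ℝ) (x : Fin 3 → ℝ) (i : Fin 3) :
      Real.exp (-ν * (k ^ 2 + m ^ 2) * t) *
        (α * (Real.cos (k * x 0 - m * x 2 - ω * t) * (![m, 0, k] i)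
          + (m * f / ω) * Real.sin (k * x 0 - m * x 2 - ω * t) * (![(0:ℝ), 1, 0] i)))
      = Real.exp (-ν * (k ^ 2 + m ^ 2) * t) * (α * ![m, 0, k] i)
          * Real.cos (k * x 0 - m * x 2 - ω * t)
        + Real.exp (-ν * (k ^ 2 + m ^ 2) * t) * (α * (m * f / ω) * ![(0:ℝ), 1, 0] i)
          * Real.sin (k * x 0 - m * x 2 - ω * t) := by ring
  have hb (t : ℝ) (x : Fin 3 → ℝ) :
      Real.exp (-ν * (k ^ 2 + m ^ 2) * t) *
        (-α * (k / ω) * ρ' * Real.sin (k * x 0 - m * x 2 - ω * t))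
      = Real.exp (-ν * (k ^ 2 + m ^ 2) * t) * 0 * Real.cos (k * x 0 - m * x 2 - ω * t)
        + Real.exp (-ν * (k ^ 2 + m ^ 2) * t) * (-α * (k / ω) * ρ')
          * Real.sin (k * x 0 - m * x 2 - ω * t) := by ring
  have hp (t : ℝ) (x : Fin 3 → ℝ) :
      Real.exp (-ν * (k ^ 2 + m ^ 2) * t) *
        (α * m * (ω ^ 2 - f ^ 2) / (k * ω) * Real.cos (k * x 0 - m * x 2 - ω * t))
      = Real.exp (-ν * (k ^ 2 + m ^ 2) * t) * (α * m * (ω ^ 2 - f ^ 2) / (k * ω))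
          * Real.cos (k * x 0 - m * x 2 - ω * t)
        + 0 * Real.sin (k * x 0 - m * x 2 - ω * t) := by ring
  simp only [hv, hb, hp]
  intro t _ x
  simp only [adv, vdiv, lap_plane_wave, pd_plane_wave, deriv_damped_wave, Fin.sum_univ_three]
  generalize Real.exp (-ν * (k ^ 2 + m ^ 2) * t) = E
  generalize Real.cos (k * x 0 - m * x 2 - ω * t) = C
  generalize Real.sin (k * x 0 - m * x 2 - ω * t) = S
  refine ⟨fun i => ?_, ?_, ?_⟩
  · fin_cases i
    · simp
      field_simp
      ring
    · simp
      field_simp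
      ring
    · simp
      field_simp
      linear_combination (E * α * S) * hdisp'
  · simp
    ring
  · simp
    field_simp
    ring
end
end

section
/- Let k₁, k₂ ∈ ℝ² with |k₁| = |k₂|, let α₁, α₂, δ₁, δ₂ ∈ ℝ, and set ψᵢ(ξ) = αᵢ sin(ξ + δᵢ) for i = 1, 2. Define the planar field v(x) = ψ₁(k₁·x) k₁⊥ + ψ₂(k₂·x) k₂⊥, where (a,b)⊥ = (−b,a). Then ∇·v = 0 and the advective term is the gradient (v·∇)v = ∇h of the scalar function h(x) = (k₁·k₂) ψ₁(k₁·x) ψ₂(k₂·x) + |k₁|² ψ₁′(k₁·x) ψ₂′(k₂·x). -/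
noncomputable section

open Real Finset

/-- The linear functional `x ↦ dot k x` as a continuous linear map. -/
def dotCLM {n : ℕ} (k : Fin n → ℝ) : (Fin n → ℝ) →L[ℝ] ℝ :=
  ∑ j, k j • ContinuousLinearMap.proj j

theorem dotCLM_apply {n : ℕ} (k x : Fin n → ℝ) : dotCLM k x = dot k x := by
  simp [dotCLM, dot]

theorem dotCLM_single {n : ℕ} (k : Fin n → ℝ) (j : Fin n) :
    dotCLM k (Pi.single j 1) = k j := by
  simp [dotCLM_apply, dot, Pi.single_apply]

theorem hasFDerivAt_dot {n : ℕ} (k x : Fin n → ℝ) :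
    HasFDerivAt (fun y => dot k y) (dotCLM k) x := by
  simpa only [← dotCLM_apply] using (dotCLM k).hasFDerivAt

theorem hasFDerivAt_comp_dot {n : ℕ} {g : ℝ → ℝ} {g' : ℝ} (k x : Fin n → ℝ)
    (hg : HasDerivAt g g' (dot k x)) :
    HasFDerivAt (fun y => g (dot k y)) (g' • dotCLM k) x :=
  hg.comp_hasFDerivAt x (hasFDerivAt_dot k x)

/-- Partial derivatives of a linear combination of two plane waves. -/
theorem pd_add_plane_waves {n : ℕ} {f g : ℝ → ℝ} {f' g' : ℝ} (k l x : Fin n → ℝ) (a b : ℝ)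
    (hf : HasDerivAt f f' (dot k x)) (hg : HasDerivAt g g' (dot l x)) (j : Fin n) :
    pd (fun y => f (dot k y) * a + g (dot l y) * b) j x = f' * k j * a + g' * l j * b := by
  have H := ((hasFDerivAt_comp_dot k x hf).mul_const a).add
    ((hasFDerivAt_comp_dot l x hg).mul_const b)
  have H' : pd (fun y => f (dot k y) * a + g (dot l y) * b) j x = _ :=
    congrArg (fun L => L (Pi.single j 1)) H.fderiv
  rw [H']
  simp [dotCLM_single]
  ring

/-- Partial derivatives of a linear combination of two products of plane waves. -/
theorem pd_add_mul_plane_waves {n : ℕ} {f g p q : ℝ → ℝ} {f' g' p' q' : ℝ}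
    (k l x : Fin n → ℝ) (a b : ℝ)
    (hf : HasDerivAt f f' (dot k x)) (hg : HasDerivAt g g' (dot l x))
    (hp : HasDerivAt p p' (dot k x)) (hq : HasDerivAt q q' (dot l x)) (j : Fin n) :
    pd (fun y => a * f (dot k y) * g (dot l y) + b * p (dot k y) * q (dot l y)) j x
      = a * (f' * k j * g (dot l x) + f (dot k x) * (g' * l j))
        + b * (p' * k j * q (dot l x) + p (dot k x) * (q' * l j)) := by
  have H := (((hasFDerivAt_comp_dot k x hf).const_mul a).mul (hasFDerivAt_comp_dot l x hg)).add
    (((hasFDerivAt_comp_dot k x hp).const_mul b).mul (hasFDerivAt_comp_dot l x hq))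
  have H' : pd (fun y => a * f (dot k y) * g (dot l y) + b * p (dot k y) * q (dot l y)) j x = _ :=
    congrArg (fun L => L (Pi.single j 1)) H.fderiv
  rw [H']
  simp [dotCLM_single]
  ring

theorem hasDerivAt_const_mul_sin_add (α δ ξ : ℝ) :
    HasDerivAt (fun t => α * Real.sin (t + δ)) (α * Real.cos (ξ + δ)) ξ := by
  simpa using (((hasDerivAt_id ξ).add_const δ).sin).const_mul α

theorem hasDerivAt_const_mul_cos_add (α δ ξ : ℝ) :
    HasDerivAt (fun t => α * Real.cos (t + δ)) (-(α * Real.sin (ξ + δ))) ξ := by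
  simpa using (((hasDerivAt_id ξ).add_const δ).cos).const_mul α

/-- For the planar field `v = ψ₁(k₁·x)k₁⊥ + ψ₂(k₂·x)k₂⊥` with
`|k₁| = |k₂|` and `ψᵢ(ξ) = αᵢ sin(ξ + δᵢ)`, one has `∇·v = 0` and
`(v·∇)v = ∇h`, where `h = (k₁·k₂)ψ₁ψ₂ + |k₁|²ψ₁′ψ₂′`. -/
theorem stmt8 (k₁ k₂ : Fin 2 → ℝ) (hlen : dot k₁ k₁ = dot k₂ k₂)
    (α₁ α₂ δ₁ δ₂ : ℝ)
    (ψ₁ ψ₂ : ℝ → ℝ)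
    (hψ₁ : ∀ ξ, ψ₁ ξ = α₁ * Real.sin (ξ + δ₁))
    (hψ₂ : ∀ ξ, ψ₂ ξ = α₂ * Real.sin (ξ + δ₂))
    (v : (Fin 2 → ℝ) → (Fin 2 → ℝ))
    (hv : ∀ x i, v x i
      = ψ₁ (dot k₁ x) * (![-(k₁ 1), k₁ 0] i) + ψ₂ (dot k₂ x) * (![-(k₂ 1), k₂ 0] i))
    (h : (Fin 2 → ℝ) → ℝ)
    (hh : ∀ x, h x = dot k₁ k₂ * ψ₁ (dot k₁ x) * ψ₂ (dot k₂ x)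
        + dot k₁ k₁ * deriv ψ₁ (dot k₁ x) * deriv ψ₂ (dot k₂ x)) :
    ∀ x, vdiv v x = 0 ∧ ∀ i, adv v v x i = pd h i x := by
  intro x
  obtain rfl : ψ₁ = fun ξ => α₁ * Real.sin (ξ + δ₁) := funext hψ₁
  obtain rfl : ψ₂ = fun ξ => α₂ * Real.sin (ξ + δ₂) := funext hψ₂
  have hd (α δ : ℝ) :
      deriv (fun ξ => α * Real.sin (ξ + δ)) = fun ξ => α * Real.cos (ξ + δ) :=
    funext fun ξ => (hasDerivAt_const_mul_sin_add α δ ξ).deriv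
  have pd_v (i j : Fin 2) := pd_add_plane_waves k₁ k₂ x (![-(k₁ 1), k₁ 0] i)
    (![-(k₂ 1), k₂ 0] i) (hasDerivAt_const_mul_sin_add α₁ δ₁ _)
    (hasDerivAt_const_mul_sin_add α₂ δ₂ _) j
  have pd_h (i : Fin 2) := pd_add_mul_plane_waves k₁ k₂ x (dot k₁ k₂) (dot k₁ k₁)
    (hasDerivAt_const_mul_sin_add α₁ δ₁ _) (hasDerivAt_const_mul_sin_add α₂ δ₂ _)
    (hasDerivAt_const_mul_cos_add α₁ δ₁ _) (hasDerivAt_const_mul_cos_add α₂ δ₂ _) i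
  simp only [← hv] at pd_v
  simp only [hd] at hh
  simp only [← hh] at pd_h
  refine ⟨?_, fun i => ?_⟩
  · simp only [vdiv, Fin.sum_univ_two, pd_v]
    simp
    ring
  · simp only [adv, Fin.sum_univ_two, pd_v, pd_h]
    simp only [hv]
    generalize α₁ * Real.sin (dot k₁ x + δ₁) = s₁
    generalize α₂ * Real.sin (dot k₂ x + δ₂) = s₂
    generalize α₁ * Real.cos (dot k₁ x + δ₁) = c₁
    generalize α₂ * Real.cos (dot k₂ x + δ₂) = c₂
    simp only [dot, Fin.sum_univ_two] at hlen ⊢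
    fin_cases i
    · simp
      linear_combination (s₁ * c₂ * k₁ 0) * hlen
    · simp
      linear_combination (s₁ * c₂ * k₁ 1) * hlen
end
end

section
/- Let ν ≥ 0, a > 0, N ≥ 1, and for 1 ≤ i ≤ N let kᵢ ∈ ℝ² with |kᵢ| = a, βᵢ, δᵢ ∈ ℝ, and ψᵢ(ξ) = βᵢ sin(ξ + δᵢ). Then the planar velocity field v(t,x) = e^{−ν a² t} Σ_{i=1}^N ψᵢ(kᵢ·x) kᵢ⊥ together with the pressure p(t,x) = −e^{−2ν a² t} Σ_{i=1}^N Σ_{j=i+1}^N ( (kᵢ·kⱼ) ψᵢ(kᵢ·x) ψⱼ(kⱼ·x) + a² ψᵢ′(kᵢ·x) ψⱼ′(kⱼ·x) ) solves the incompressible Navier–Stokes equations on ℝ² with viscosity ν and density ρ₀ = 1. -/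
noncomputable section

open Real Finset

/-- The incompressible Navier–Stokes equations on ℝⁿ with viscosity `ν` and constant
density `ρ₀`: `∂t v + (v·∇)v = −(1/ρ₀)∇p + νΔv`, `∇·v = 0`, for `t ≥ 0`. -/
def IsNavierStokes (n : ℕ) (ν ρ₀ : ℝ) (v : ℝ → (Fin n → ℝ) → (Fin n → ℝ))
    (p : ℝ → (Fin n → ℝ) → ℝ) : Prop :=
  ∀ t, 0 ≤ t → ∀ x : Fin n → ℝ,
    (∀ i, deriv (fun s => v s x i) t + adv (v t) (v t) x i
        = -(1 / ρ₀) * pd (p t) i x + ν * lap (fun y => v t y i) x)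
    ∧ vdiv (v t) x = 0

theorem hasFDerivAt_dot_s10 {n : ℕ} (k x : Fin n → ℝ) :
    HasFDerivAt (dot k) (∑ j, k j • (ContinuousLinearMap.proj j : (Fin n → ℝ) →L[ℝ] ℝ)) x := by
  unfold dot
  exact HasFDerivAt.fun_sum fun j _ => (hasFDerivAt_apply j x).const_mul (k j)

/-- `pd f j x = d`, together with differentiability of `f` at `x`. -/
def HasPd {n : ℕ} (f : (Fin n → ℝ) → ℝ) (j : Fin n) (x : Fin n → ℝ) (d : ℝ) : Prop :=
  DifferentiableAt ℝ f x ∧ pd f j x = d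

namespace HasPd

variable {n : ℕ} {f g : (Fin n → ℝ) → ℝ} {j : Fin n} {x : Fin n → ℝ} {d e : ℝ}

theorem of_hasFDerivAt {L : (Fin n → ℝ) →L[ℝ] ℝ} (h : HasFDerivAt f L x) :
    HasPd f j x (L (Pi.single j 1)) :=
  ⟨h.differentiableAt, by rw [pd, h.fderiv]⟩

theorem dot_add (k : Fin n → ℝ) (δ : ℝ) : HasPd (fun y => dot k y + δ) j x (k j) := by
  convert of_hasFDerivAt (j := j) ((hasFDerivAt_dot_s10 k x).add_const δ) using 1
  simp [Pi.single_apply]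

theorem add (hf : HasPd f j x d) (hg : HasPd g j x e) :
    HasPd (fun y => f y + g y) j x (d + e) := by
  obtain ⟨hf, rfl⟩ := hf
  obtain ⟨hg, rfl⟩ := hg
  exact of_hasFDerivAt (hf.hasFDerivAt.add hg.hasFDerivAt)

theorem mul (hf : HasPd f j x d) (hg : HasPd g j x e) :
    HasPd (fun y => f y * g y) j x (d * g x + f x * e) := by
  obtain ⟨hf, rfl⟩ := hf
  obtain ⟨hg, rfl⟩ := hg
  refine ⟨hf.mul hg, ?_⟩
  rw [pd, (hf.hasFDerivAt.fun_mul hg.hasFDerivAt).fderiv]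
  simp only [add_apply, smul_apply, smul_eq_mul, pd]
  ring

theorem const_mul (c : ℝ) (hf : HasPd f j x d) : HasPd (fun y => c * f y) j x (c * d) := by
  obtain ⟨hf, rfl⟩ := hf
  exact of_hasFDerivAt (hf.hasFDerivAt.const_mul c)

theorem mul_const (c : ℝ) (hf : HasPd f j x d) : HasPd (fun y => f y * c) j x (d * c) := by
  simpa only [mul_comm _ c] using hf.const_mul c

theorem sum {ι : Type*} {s : Finset ι} {F : ι → (Fin n → ℝ) → ℝ} {D : ι → ℝ}
    (h : ∀ i ∈ s, HasPd (F i) j x (D i)) :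
    HasPd (fun y => ∑ i ∈ s, F i y) j x (∑ i ∈ s, D i) := by
  convert of_hasFDerivAt (j := j)
    (HasFDerivAt.fun_sum fun i hi => (h i hi).1.hasFDerivAt) using 1
  rw [_root_.sum_apply]
  exact Finset.sum_congr rfl fun i hi => (h i hi).2.symm

theorem sin_wave (k : Fin n → ℝ) (β δ : ℝ) :
    HasPd (fun y => β * Real.sin (dot k y + δ)) j x
      (β * Real.cos (dot k x + δ) * k j) := by
  obtain ⟨hd, hk⟩ := dot_add (j := j) (x := x) k δ
  convert of_hasFDerivAt (j := j) (hd.hasFDerivAt.sin.const_mul β) using 1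
  simp only [smul_apply, smul_eq_mul, ← hk, pd]
  ring

theorem cos_wave (k : Fin n → ℝ) (β δ : ℝ) :
    HasPd (fun y => β * Real.cos (dot k y + δ)) j x
      (-(β * Real.sin (dot k x + δ)) * k j) := by
  obtain ⟨hd, hk⟩ := dot_add (j := j) (x := x) k δ
  convert of_hasFDerivAt (j := j) (hd.hasFDerivAt.cos.const_mul β) using 1
  simp only [smul_apply, smul_eq_mul, ← hk, pd]
  ring

end HasPd

/-- A symmetrised sum over pairs `i < j` is the full double sum when the diagonal vanishes. -/
theorem sum_Ioi_add_swap {N : ℕ} (G : Fin N → Fin N → ℝ) (hG : ∀ i, G i i = 0) :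
    ∑ i, ∑ j ∈ Finset.Ioi i, (G i j + G j i) = ∑ i, ∑ j, G i j := by
  rw [Finset.sum_sum_Ioi_add_eq_sum_sum_off_diag fun i j => G j i]
  refine Finset.sum_congr rfl fun i _ => ?_
  rw [← Finset.sum_compl_add_sum {i}, Finset.sum_singleton, hG, add_zero]

section Waves

variable {N : ℕ} (k : Fin N → Fin 2 → ℝ) (β δ : Fin N → ℝ) (c : ℝ) (x : Fin 2 → ℝ)

/-- Partial derivatives of a superposition of sine waves with amplitudes `w`. -/
theorem hasPd_sin_waves (w : Fin N → ℝ) (m : Fin 2) :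
    HasPd (fun y => c * ∑ j, β j * Real.sin (dot (k j) y + δ j) * w j) m x
      (c * ∑ j, β j * Real.cos (dot (k j) x + δ j) * k j m * w j) :=
  (HasPd.sum fun j _ => (HasPd.sin_wave (k j) (β j) (δ j)).mul_const (w j)).const_mul c

theorem lap_sin_waves (a : ℝ) (hk : ∀ i, dot (k i) (k i) = a ^ 2) (w : Fin N → ℝ) :
    lap (fun y => c * ∑ j, β j * Real.sin (dot (k j) y + δ j) * w j) x
      = -a ^ 2 * (c * ∑ j, β j * Real.sin (dot (k j) x + δ j) * w j) := by
  have h (m : Fin 2) : pd (fun y =>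
      pd (fun y => c * ∑ j, β j * Real.sin (dot (k j) y + δ j) * w j) m y) m x
      = c * ∑ j, -(β j * Real.sin (dot (k j) x + δ j)) * k j m * k j m * w j := by
    simp only [(hasPd_sin_waves k β δ c _ w m).2]
    exact ((HasPd.sum (s := Finset.univ) fun j _ => ((HasPd.cos_wave (k j) (β j) (δ j)).mul_const
      (k j m)).mul_const (w j)).const_mul c).2
  simp only [lap, h]
  simp only [Fin.sum_univ_two, Finset.mul_sum, ← Finset.sum_add_distrib]
  refine Finset.sum_congr rfl fun j _ => ?_
  have := hk j
  simp only [dot, Fin.sum_univ_two] at this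
  rw [← this]
  ring

theorem pd_pressure (a : ℝ) (hk : ∀ i, dot (k i) (k i) = a ^ 2) (m : Fin 2) :
    pd (fun x => c * ∑ i, ∑ j ∈ Finset.Ioi i,
          (dot (k i) (k j) * (β i * Real.sin (dot (k i) x + δ i))
              * (β j * Real.sin (dot (k j) x + δ j))
           + a ^ 2 * (β i * Real.cos (dot (k i) x + δ i))
              * (β j * Real.cos (dot (k j) x + δ j)))) m x
      = c * ∑ i, ∑ j, β i * Real.sin (dot (k i) x + δ i)
          * (β j * Real.cos (dot (k j) x + δ j))
          * (dot (k i) (k j) * k j m - a ^ 2 * k i m) := by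
  rw [← sum_Ioi_add_swap _ fun i => by rw [hk]; ring]
  rw [(((HasPd.sum (s := Finset.univ) fun i _ => HasPd.sum (s := Finset.Ioi i) fun j _ =>
    (((HasPd.sin_wave (k i) (β i) (δ i)).const_mul (dot (k i) (k j))).mul
      (HasPd.sin_wave (k j) (β j) (δ j))).add
    (((HasPd.cos_wave (k i) (β i) (δ i)).const_mul (a ^ 2)).mul
      (HasPd.cos_wave (k j) (β j) (δ j)))).const_mul c).2)]
  congr 1
  refine Finset.sum_congr rfl fun i _ => Finset.sum_congr rfl fun j _ => ?_
  have : dot (k j) (k i) = dot (k i) (k j) := by simp only [dot, mul_comm]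
  rw [this]
  ring

/-- The advection of a superposition of plane shear waves of equal wave number. -/
theorem adv_shear_waves (a : ℝ) (hk : ∀ i, dot (k i) (k i) = a ^ 2) (m : Fin 2) :
    adv (fun x i => c * ∑ j, β j * Real.sin (dot (k j) x + δ j) * (![-(k j 1), k j 0] i))
        (fun x i => c * ∑ j, β j * Real.sin (dot (k j) x + δ j) * (![-(k j 1), k j 0] i)) x m
      = c * c * ∑ i, ∑ j, β i * Real.sin (dot (k i) x + δ i)
          * (β j * Real.cos (dot (k j) x + δ j))
          * (dot (k i) (k j) * k j m - a ^ 2 * k i m) := by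
  simp only [adv, (hasPd_sin_waves k β δ c x (fun j => ![-(k j 1), k j 0] m) _).2,
    mul_mul_mul_comm c _ c, Finset.sum_mul_sum, ← Finset.mul_sum]
  rw [Finset.sum_comm]
  congr 1
  refine Finset.sum_congr rfl fun i _ => ?_
  simp only [Finset.mul_sum]
  rw [Finset.sum_comm]
  refine Finset.sum_congr rfl fun j _ => ?_
  rw [← hk j]
  fin_cases m <;> simp [dot, Fin.sum_univ_two] <;> ring

end Waves

/-- The planar velocity field `v = e^{−νa²t} Σᵢ ψᵢ(kᵢ·x)kᵢ⊥` with
`|kᵢ| = a` and `ψᵢ(ξ) = βᵢ sin(ξ+δᵢ)`, together with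
`p = −e^{−2νa²t} Σᵢ Σ_{j>i} ((kᵢ·kⱼ)ψᵢψⱼ + a²ψᵢ′ψⱼ′)`,
solves the incompressible Navier–Stokes equations on ℝ² with density `ρ₀ = 1`. -/
theorem stmt10 (ν a : ℝ) (hν : 0 ≤ ν) (ha : 0 < a) (N : ℕ) (hN : 1 ≤ N)
    (k : Fin N → Fin 2 → ℝ) (hk : ∀ i, dot (k i) (k i) = a ^ 2)
    (β δ : Fin N → ℝ) :
    IsNavierStokes 2 ν 1
      (fun t x i => Real.exp (-ν * a ^ 2 * t) *
        ∑ j, β j * Real.sin (dot (k j) x + δ j) * (![-(k j 1), k j 0] i))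
      (fun t x => -Real.exp (-2 * ν * a ^ 2 * t) *
        ∑ i, ∑ j ∈ Finset.Ioi i,
          (dot (k i) (k j) * (β i * Real.sin (dot (k i) x + δ i))
              * (β j * Real.sin (dot (k j) x + δ j))
           + a ^ 2 * (β i * Real.cos (dot (k i) x + δ i))
              * (β j * Real.cos (dot (k j) x + δ j)))) := by
  intro t _ x
  refine ⟨fun m => ?_, ?_⟩
  · have hE : Real.exp (-2 * ν * a ^ 2 * t)
        = Real.exp (-ν * a ^ 2 * t) * Real.exp (-ν * a ^ 2 * t) := by
      rw [← Real.exp_add]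
      ring_nf
    have hd : HasDerivAt (fun s => Real.exp (-ν * a ^ 2 * s))
        (Real.exp (-ν * a ^ 2 * t) * (-ν * a ^ 2)) t := by
      simpa only [id, mul_one] using ((hasDerivAt_id t).const_mul (-ν * a ^ 2)).exp
    rw [(hd.mul_const _).deriv, adv_shear_waves k β δ _ x a hk m,
      pd_pressure k β δ _ x a hk m,
      lap_sin_waves k β δ _ x a hk fun j => ![-(k j 1), k j 0] m, hE]
    ring
  · simp only [vdiv, (hasPd_sin_waves k β δ _ x (fun j => ![-(k j 1), k j 0] _) _).2,
      ← Finset.mul_sum]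
    rw [Finset.sum_comm]
    refine mul_eq_zero_of_right _ (Finset.sum_eq_zero fun j _ => ?_)
    simp [Fin.sum_univ_two]
    ring
end
end

section
/- Let n ≥ 2, ν ≥ 0, ρ₀ > 0, 1 ≤ N < n, and for 1 ≤ i ≤ N let aᵢ ∈ ℝⁿ, Mᵢ ≥ 1, and for 1 ≤ j ≤ Mᵢ let k_{i,j} ∈ ℝⁿ and ψ_{i,j} ∈ C²(ℝ≥0 × ℝ, ℝ); let c ∈ ℝⁿ. Assume aᵢ·k_{j,ℓ} = 0 for all 1 ≤ ℓ ≤ Mⱼ, 1 ≤ i, j ≤ N, that each ψ_{i,j} solves the one-dimensional heat equation ∂tψ_{i,j} = ν|k_{i,j}|² ∂²ξψ_{i,j}, and set ω_{i,j} = c·k_{i,j}. Then the transverse flow v(t,x) = Σ_{i=1}^N aᵢ Σ_{j=1}^{Mᵢ} ψ_{i,j}(t, k_{i,j}·x − ω_{i,j} t) + c together with any spatially constant pressure p(t,x) = p̃(t) solves the incompressible Navier–Stokes equations on ℝⁿ. -/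
noncomputable section

open Real Finset

theorem hasFDerivAt_comp_dot_s13 {n : ℕ} {g : ℝ → ℝ} (hg : Differentiable ℝ g)
    (k : Fin n → ℝ) (b : ℝ) (x : Fin n → ℝ) :
    HasFDerivAt (fun y => g (dot k y - b))
      (deriv g (dot k x - b) • ∑ j, k j • ContinuousLinearMap.proj (R := ℝ) (φ := fun _ => ℝ) j) x := by
  have hdot : HasFDerivAt (fun y => dot k y - b)
      (∑ j, k j • ContinuousLinearMap.proj (R := ℝ) (φ := fun _ => ℝ) j) x := by
    unfold dot
    exact (HasFDerivAt.fun_sum fun j _ => (hasFDerivAt_apply j x).const_mul (k j)).sub_const b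
  exact (hg _).hasDerivAt.comp_hasFDerivAt x hdot

/-- Partial derivatives of a finite superposition of plane waves. -/
theorem pd_sum_comp_dot {n N : ℕ} {M : Fin N → ℕ} {G : (i : Fin N) → Fin (M i) → ℝ → ℝ}
    (hG : ∀ i j, Differentiable ℝ (G i j)) (k : (i : Fin N) → Fin (M i) → Fin n → ℝ)
    (b : (i : Fin N) → Fin (M i) → ℝ) (A : Fin N → ℝ) (C : ℝ) (d : Fin n) (x : Fin n → ℝ) :
    pd (fun y => (∑ i, (∑ j, G i j (dot (k i j) y - b i j)) * A i) + C) d x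
      = ∑ i, (∑ j, deriv (G i j) (dot (k i j) x - b i j) * k i j d) * A i := by
  have h := (HasFDerivAt.fun_sum (u := univ) fun i _ =>
    (HasFDerivAt.fun_sum (u := univ) fun j _ =>
      hasFDerivAt_comp_dot_s13 (hG i j) (k i j) (b i j) x).mul_const (A i)).add_const C
  rw [pd, h.fderiv]
  simp [Pi.single_apply, mul_comm]

/-- The Laplacian of a finite superposition of plane waves. -/
theorem lap_sum_comp_dot {n N : ℕ} {M : Fin N → ℕ} {G : (i : Fin N) → Fin (M i) → ℝ → ℝ}
    (hG : ∀ i j, ContDiff ℝ 2 (G i j)) (k : (i : Fin N) → Fin (M i) → Fin n → ℝ)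
    (b : (i : Fin N) → Fin (M i) → ℝ) (A : Fin N → ℝ) (C : ℝ) (x : Fin n → ℝ) :
    lap (fun y => (∑ i, (∑ j, G i j (dot (k i j) y - b i j)) * A i) + C) x
      = ∑ i, (∑ j, dot (k i j) (k i j) * deriv (deriv (G i j)) (dot (k i j) x - b i j)) * A i := by
  have hG' : ∀ i j, Differentiable ℝ (deriv (G i j)) := fun i j =>
    (hG i j).differentiable_deriv_two
  have hd : ∀ d : Fin n,
      pd (fun y => pd (fun y => (∑ i, (∑ j, G i j (dot (k i j) y - b i j)) * A i) + C) d y) d x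
        = ∑ i, (∑ j, deriv (deriv (G i j)) (dot (k i j) x - b i j) * k i j d * k i j d) * A i := by
    intro d
    simp_rw [pd_sum_comp_dot (fun i j => (hG i j).differentiable two_ne_zero) k b A C d]
    have h := pd_sum_comp_dot (G := fun i j ξ => deriv (G i j) ξ * k i j d)
      (fun i j => (hG' i j).mul_const _) k b A 0 d x
    simpa [deriv_mul_const_field] using h
  simp only [lap, hd]
  rw [sum_comm]
  refine sum_congr rfl fun i _ => ?_
  rw [← sum_mul, sum_comm]
  congr 1
  refine sum_congr rfl fun j _ => ?_
  rw [show dot (k i j) (k i j) = ∑ d, k i j d * k i j d from rfl, sum_mul]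
  exact sum_congr rfl fun d _ => by ring

/-- Time derivative of a profile along a point moving with constant speed `-w`. -/
theorem hasDerivAt_comp_sub_mul {f : ℝ → ℝ → ℝ} (hf : Differentiable ℝ (Function.uncurry f))
    (m w t : ℝ) :
    HasDerivAt (fun s => f s (m - w * s))
      (deriv (fun s => f s (m - w * t)) t - w * deriv (f t) (m - w * t)) t := by
  have hF : HasFDerivAt (Function.uncurry f) (fderiv ℝ (Function.uncurry f) (t, m - w * t))
      (t, m - w * t) := (hf _).hasFDerivAt
  have hpath : HasDerivAt (fun s => (s, m - w * s)) ((1 : ℝ), -w) t := by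
    simpa using (hasDerivAt_id t).prodMk (((hasDerivAt_id t).const_mul w).const_sub m)
  have hfst : HasDerivAt (fun s => f s (m - w * t)) _ t :=
    HasFDerivAt.comp_hasDerivAt (l := Function.uncurry f) t hF
      ((hasDerivAt_id t).prodMk (hasDerivAt_const t (m - w * t)))
  have hsnd : HasDerivAt (f t) _ (m - w * t) :=
    hF.comp_hasDerivAt (m - w * t)
      ((hasDerivAt_const (m - w * t) t).prodMk (hasDerivAt_id (m - w * t)))
  have hcomp : HasDerivAt (fun s => f s (m - w * s)) _ t :=
    HasFDerivAt.comp_hasDerivAt (l := Function.uncurry f) t hF hpath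
  rw [hfst.deriv, hsnd.deriv]
  convert hcomp using 1
  rw [← smul_eq_mul w (fderiv _ _ _ _), ← map_smul, ← map_sub]
  simp

theorem sum_mul_sum_mul {n N : ℕ} {M : Fin N → ℕ} (U : Fin n → ℝ)
    (P : (i : Fin N) → Fin (M i) → ℝ) (k : (i : Fin N) → Fin (M i) → Fin n → ℝ) (A : Fin N → ℝ) :
    ∑ d, U d * ∑ i, (∑ j, P i j * k i j d) * A i
      = ∑ i, (∑ j, (∑ d, U d * k i j d) * P i j) * A i := by
  simp only [mul_sum, sum_mul]
  rw [sum_comm]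
  refine sum_congr rfl fun i _ => ?_
  rw [sum_comm]
  exact sum_congr rfl fun j _ => sum_congr rfl fun d _ => by ring

theorem dot_transverse {n N : ℕ} (S : Fin N → ℝ) (a : Fin N → Fin n → ℝ) (c k : Fin n → ℝ)
    (h : ∀ i, dot (a i) k = 0) :
    ∑ d, ((∑ i, S i * a i d) + c d) * k d = dot c k := by
  simp only [add_mul, sum_add_distrib, sum_mul]
  rw [sum_comm]
  simp only [mul_assoc, ← mul_sum]
  simp only [dot] at h ⊢
  simp [h]

/-- The transverse flow
`v(t,x) = Σᵢ aᵢ Σⱼ ψ_{i,j}(t, k_{i,j}·x − ω_{i,j}t) + c` with the orthogonality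
conditions `aᵢ·k_{j,ℓ} = 0`, heat equations `∂tψ_{i,j} = ν|k_{i,j}|²∂ξξψ_{i,j}` and
frequencies `ω_{i,j} = c·k_{i,j}`, together with any spatially constant pressure
`p(t,x) = p̃(t)`, solves the incompressible Navier–Stokes equations on ℝⁿ. -/
theorem stmt13 (n N : ℕ) (hn : 2 ≤ n) (hN1 : 1 ≤ N) (hNn : N < n)
    (ν ρ₀ : ℝ) (hν : 0 ≤ ν) (hρ : 0 < ρ₀)
    (a : Fin N → Fin n → ℝ) (M : Fin N → ℕ) (hM : ∀ i, 1 ≤ M i)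
    (ψ : (i : Fin N) → Fin (M i) → ℝ → ℝ → ℝ)
    (hψ : ∀ i j, ContDiff ℝ 2 (Function.uncurry (ψ i j)))
    (k : (i : Fin N) → Fin (M i) → Fin n → ℝ) (c : Fin n → ℝ)
    (horth : ∀ (i j : Fin N) (l : Fin (M j)), dot (a i) (k j l) = 0)
    (hheat : ∀ i j t ξ, 0 ≤ t →
      deriv (fun s => ψ i j s ξ) t = ν * dot (k i j) (k i j) * deriv (deriv (ψ i j t)) ξ)
    (ω : (i : Fin N) → Fin (M i) → ℝ) (hω : ∀ i j, ω i j = dot c (k i j))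
    (ptil : ℝ → ℝ) :
    IsNavierStokes n ν ρ₀
      (fun t x d => (∑ i, (∑ j, ψ i j t (dot (k i j) x - ω i j * t)) * a i d) + c d)
      (fun t _ => ptil t) := by
  intro t ht x
  have hslice : ∀ i j, ContDiff ℝ 2 (ψ i j t) := fun i j =>
    (hψ i j).comp (contDiff_prodMk_right t)
  have hdiff : ∀ i j, Differentiable ℝ (ψ i j t) := fun i j =>
    (hslice i j).differentiable two_ne_zero
  have hpd := fun e d : Fin n =>
    pd_sum_comp_dot hdiff k (fun i j => ω i j * t) (fun i => a i e) (c e) d x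
  refine ⟨fun e => ?_, ?_⟩
  · have htime := ((HasDerivAt.fun_sum (u := univ) fun i _ =>
      (HasDerivAt.fun_sum (u := univ) fun j _ =>
        hasDerivAt_comp_sub_mul ((hψ i j).differentiable two_ne_zero)
          (dot (k i j) x) (ω i j) t).mul_const (a i e)).add_const (c e)).deriv
    have hadv : adv
        (fun x d => (∑ i, (∑ j, ψ i j t (dot (k i j) x - ω i j * t)) * a i d) + c d)
        (fun x d => (∑ i, (∑ j, ψ i j t (dot (k i j) x - ω i j * t)) * a i d) + c d) x e
        = ∑ i, (∑ j, ω i j * deriv (ψ i j t) (dot (k i j) x - ω i j * t)) * a i e := by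
      simp only [adv, hpd]
      rw [sum_mul_sum_mul]
      refine sum_congr rfl fun i _ => ?_
      congr 1
      refine sum_congr rfl fun j _ => ?_
      rw [hω i j, dot_transverse _ a c (k i j) fun l => horth l i j]
    have hp : pd (fun _ : Fin n → ℝ => ptil t) e x = 0 := by simp [pd]
    rw [hadv, hp, lap_sum_comp_dot hslice k (fun i j => ω i j * t) (fun i => a i e) (c e) x, htime,
      ← sum_add_distrib, mul_zero, zero_add, mul_sum]
    refine sum_congr rfl fun i _ => ?_
    rw [← add_mul, ← sum_add_distrib, ← mul_assoc, mul_sum]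
    congr 1
    refine sum_congr rfl fun j _ => ?_
    rw [hheat i j t _ ht]
    ring
  · simp only [vdiv, hpd]
    simp only [sum_mul]
    rw [sum_comm]
    refine sum_eq_zero fun i _ => ?_
    rw [sum_comm]
    refine sum_eq_zero fun j _ => ?_
    have h := horth i i j
    rw [dot] at h
    calc _ = deriv (ψ i j t) (dot (k i j) x - ω i j * t) * ∑ d, a i d * k i j d := by
          rw [mul_sum]
          exact sum_congr rfl fun d _ => by ring
      _ = 0 := by rw [h, mul_zero]
end
end

section
/- Let ν ≥ 0, ρ₀ > 0, λ > 0, M ≥ 1, γ ∈ ℝ, c ∈ ℝ³, and for 1 ≤ j ≤ M let kⱼ ∈ ℝ² with |kⱼ| = λ, αⱼ, δⱼ ∈ ℝ; write k̄ⱼ = (kⱼ, 0) ∈ ℝ³, k̄ⱼ⊥ = (−(kⱼ)₂, (kⱼ)₁, 0), ωⱼ = c·k̄ⱼ, and ξⱼ(t,x) = k̄ⱼ·x − ωⱼ t + δⱼ. Then the superposition of an interacting transverse flow with parallel flows, v(t,x) = e^{−νλ²t} Σ_{j=1}^M αⱼ ( sin(ξⱼ) k̄ⱼ⊥ + γ cos(ξⱼ)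 e₃ ) + c, together with pressure p(t,x) = p̃(t) − ρ₀ e^{−2νλ²t} Σ_{j=1}^M Σ_{ℓ=j+1}^M αⱼ αℓ ( (kⱼ·kℓ) sin(ξⱼ) sin(ξℓ) + λ² cos(ξⱼ) cos(ξℓ) ), solves the incompressible Navier–Stokes equations on ℝ³; the nonlinear terms generated by the additional e₃-components cancel, so the pressure is the same as without them. -/
noncomputable section

open Real Finset

/-- The value at time `t` of a superposition of plane waves on ℝ³ with horizontal wave vectors. -/
def waveSum {M : ℕ} (k : Fin M → Fin 2 → ℝ) (ω δ A B : Fin M → ℝ) (t : ℝ) (x : Fin 3 → ℝ) : ℝ :=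
  ∑ j, (A j * Real.sin (k j 0 * x 0 + k j 1 * x 1 - ω j * t + δ j)
    + B j * Real.cos (k j 0 * x 0 + k j 1 * x 1 - ω j * t + δ j))

/-- The directional derivative of `waveSum` along the `d`-th coordinate vector. -/
def waveSumDeriv {M : ℕ} (k : Fin M → Fin 2 → ℝ) (ω δ A B : Fin M → ℝ) (t : ℝ) (d : Fin 3)
    (x : Fin 3 → ℝ) : ℝ :=
  waveSum k ω δ (fun j => -(B j * ![k j 0, k j 1, 0] d)) (fun j => A j * ![k j 0, k j 1, 0] d) t x

section waveSum

variable {M : ℕ} (k : Fin M → Fin 2 → ℝ) (ω δ A B : Fin M → ℝ) (t : ℝ) (x : Fin 3 → ℝ)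

lemma differentiable_waveSum : Differentiable ℝ (waveSum k ω δ A B t) := by
  unfold waveSum
  fun_prop

lemma pd_waveSum (d : Fin 3) :
    pd (waveSum k ω δ A B t) d x = waveSumDeriv k ω δ A B t d x := by
  have hphase (j : Fin M) :
      HasFDerivAt (fun y : Fin 3 → ℝ => k j 0 * y 0 + k j 1 * y 1 - ω j * t + δ j)
        (k j 0 • ContinuousLinearMap.proj (R := ℝ) (φ := fun _ : Fin 3 => ℝ) 0
          + k j 1 • ContinuousLinearMap.proj (R := ℝ) (φ := fun _ : Fin 3 => ℝ) 1) x :=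
    ((((hasFDerivAt_apply 0 x).const_mul _).add
      ((hasFDerivAt_apply 1 x).const_mul _)).sub_const _).add_const _
  have h : HasFDerivAt (waveSum k ω δ A B t) _ x :=
    HasFDerivAt.fun_sum (u := univ) fun j _ =>
      ((hphase j).sin.const_mul (A j)).add ((hphase j).cos.const_mul (B j))
  rw [pd, h.fderiv, waveSumDeriv, waveSum, _root_.sum_apply]
  refine sum_congr rfl fun j _ => ?_
  fin_cases d <;> simp <;> ring

lemma pd_affine_waveSum (E C : ℝ) (d : Fin 3) :
    pd (fun y => E * waveSum k ω δ A B t y + C) d x = E * waveSumDeriv k ω δ A B t d x := by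
  have h := (((differentiable_waveSum k ω δ A B t x).hasFDerivAt.const_mul E).add_const C).fderiv
  rw [pd, h, ← pd_waveSum]
  rfl

lemma lap_affine_waveSum {lam : ℝ} (hk : ∀ j, (k j 0) ^ 2 + (k j 1) ^ 2 = lam ^ 2) (E C : ℝ) :
    lap (fun y => E * waveSum k ω δ A B t y + C) x = -(lam ^ 2 * (E * waveSum k ω δ A B t x)) := by
  have h (d : Fin 3) (A' B' : Fin M → ℝ) :
      pd (fun y => E * waveSum k ω δ A' B' t y) d x = E * waveSumDeriv k ω δ A' B' t d x := by
    simpa only [add_zero] using pd_affine_waveSum k ω δ A' B' t x E 0 d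
  simp only [lap, pd_affine_waveSum, Fin.sum_univ_three]
  simp only [waveSumDeriv, h]
  simp only [waveSum, mul_sum, ← sum_add_distrib, ← sum_neg_distrib]
  refine sum_congr rfl fun j _ => ?_
  rw [← hk j]
  simp
  ring

lemma hasDerivAt_waveSum (c : Fin 3 → ℝ) (hω : ∀ j, ω j = c 0 * k j 0 + c 1 * k j 1) :
    HasDerivAt (fun s => waveSum k ω δ A B s x)
      (-(∑ d, c d * waveSumDeriv k ω δ A B t d x)) t := by
  have hphase (j : Fin M) :
      HasDerivAt (fun s : ℝ => k j 0 * x 0 + k j 1 * x 1 - ω j * s + δ j) (-(ω j * 1)) t :=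
    (((hasDerivAt_id t).const_mul (ω j)).const_sub _).add_const _
  have h : HasDerivAt (fun s => waveSum k ω δ A B s x) _ t :=
    HasDerivAt.fun_sum (u := univ) fun j _ =>
      ((hphase j).sin.const_mul (A j)).add ((hphase j).cos.const_mul (B j))
  refine h.congr_deriv ?_
  simp only [Fin.sum_univ_three, waveSumDeriv, waveSum, mul_sum, ← sum_add_distrib,
    ← sum_neg_distrib]
  refine sum_congr rfl fun j _ => ?_
  simp [hω j]
  ring

end waveSum

lemma two_mul_sum_sum_Ioi {M : ℕ} (f : Fin M → Fin M → ℝ) (hf : ∀ j l, f j l = f l j) :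
    2 * ∑ j, ∑ l ∈ Ioi j, f j l = ∑ j, ∑ l, f j l - ∑ j, f j j := by
  have h := sum_sum_Ioi_add_eq_sum_sum_off_diag f
  simp only [fun i j => hf j i, ← two_mul, ← mul_sum] at h
  rw [← sum_sub_distrib, h]
  refine sum_congr rfl fun j _ => ?_
  rw [eq_sub_iff_add_eq', ← Fintype.sum_eq_add_sum_compl]

/-- Superposition of an interacting transverse flow with parallel flows on ℝ³:
`v = e^{−νλ²t} Σⱼ αⱼ(sin(ξⱼ) k̄ⱼ⊥ + γ cos(ξⱼ) e₃) + c`, `ξⱼ = k̄ⱼ·x − ωⱼt + δⱼ`,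
`|kⱼ| = λ`, `ωⱼ = c·k̄ⱼ`, with pressure
`p = p̃(t) − ρ₀ e^{−2νλ²t} Σⱼ Σ_{ℓ>j} αⱼαℓ((kⱼ·kℓ) sin ξⱼ sin ξℓ + λ² cos ξⱼ cos ξℓ)`,
solves the incompressible Navier–Stokes equations on ℝ³. -/
theorem stmt17 (ν ρ₀ lam γ : ℝ) (hν : 0 ≤ ν) (hρ : 0 < ρ₀) (hlam : 0 < lam)
    (M : ℕ) (hM : 1 ≤ M) (c : Fin 3 → ℝ)
    (k : Fin M → Fin 2 → ℝ) (hk : ∀ j, (k j 0) ^ 2 + (k j 1) ^ 2 = lam ^ 2)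
    (α δ : Fin M → ℝ)
    (ω : Fin M → ℝ) (hω : ∀ j, ω j = c 0 * k j 0 + c 1 * k j 1)
    (ptil : ℝ → ℝ) :
    IsNavierStokes 3 ν ρ₀
      (fun t x i => Real.exp (-ν * lam ^ 2 * t) *
          (∑ j, α j *
            (Real.sin (k j 0 * x 0 + k j 1 * x 1 - ω j * t + δ j) * (![-(k j 1), k j 0, 0] i)
             + γ * Real.cos (k j 0 * x 0 + k j 1 * x 1 - ω j * t + δ j) * (![(0:ℝ), 0, 1] i)))
        + c i)
      (fun t x => ptil t - ρ₀ * Real.exp (-2 * ν * lam ^ 2 * t) *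
          ∑ j, ∑ l ∈ Finset.Ioi j, α j * α l *
            ((k j 0 * k l 0 + k j 1 * k l 1)
                * Real.sin (k j 0 * x 0 + k j 1 * x 1 - ω j * t + δ j)
                * Real.sin (k l 0 * x 0 + k l 1 * x 1 - ω l * t + δ l)
             + lam ^ 2
                * Real.cos (k j 0 * x 0 + k j 1 * x 1 - ω j * t + δ j)
                * Real.cos (k l 0 * x 0 + k l 1 * x 1 - ω l * t + δ l))) := by
  set A : Fin 3 → Fin M → ℝ := fun i j => α j * ![-(k j 1), k j 0, 0] i with hA
  set B : Fin 3 → Fin M → ℝ := fun i j => α j * γ * ![(0:ℝ), 0, 1] i with hB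
  set V : Fin 3 → ℝ → (Fin 3 → ℝ) → ℝ := fun i => waveSum k ω δ (A i) (B i) with hV
  set Ψ : ℝ → (Fin 3 → ℝ) → ℝ := waveSum k ω δ 0 α with hΨ
  have hvel (t : ℝ) (x : Fin 3 → ℝ) (i : Fin 3) :
      (∑ j, α j *
        (Real.sin (k j 0 * x 0 + k j 1 * x 1 - ω j * t + δ j) * (![-(k j 1), k j 0, 0] i)
          + γ * Real.cos (k j 0 * x 0 + k j 1 * x 1 - ω j * t + δ j) * (![(0:ℝ), 0, 1] i)))
        = V i t x :=
    sum_congr rfl fun j _ => by simp only [hA, hB]; ring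
  have hpres (t : ℝ) (x : Fin 3 → ℝ) :
      (∑ j, ∑ l ∈ Finset.Ioi j, α j * α l *
        ((k j 0 * k l 0 + k j 1 * k l 1)
            * Real.sin (k j 0 * x 0 + k j 1 * x 1 - ω j * t + δ j)
            * Real.sin (k l 0 * x 0 + k l 1 * x 1 - ω l * t + δ l)
          + lam ^ 2
            * Real.cos (k j 0 * x 0 + k j 1 * x 1 - ω j * t + δ j)
            * Real.cos (k l 0 * x 0 + k l 1 * x 1 - ω l * t + δ l)))
        = (V 0 t x ^ 2 + V 1 t x ^ 2 + lam ^ 2 * Ψ t x ^ 2 - ∑ j, α j ^ 2 * lam ^ 2) / 2 := by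
    rw [eq_div_iff two_ne_zero, mul_comm, two_mul_sum_sum_Ioi _ fun j l => by ring]
    congr 1
    · simp only [hV, hΨ, waveSum, sq (Finset.sum _ _), sum_mul_sum]
      simp only [mul_sum, ← sum_add_distrib]
      refine sum_congr rfl fun j _ => sum_congr rfl fun l _ => ?_
      simp [hA, hB]
      ring
    · refine sum_congr rfl fun j _ => ?_
      linear_combination α j ^ 2 * Real.sin (k j 0 * x 0 + k j 1 * x 1 - ω j * t + δ j) ^ 2 * hk j
        + α j ^ 2 * lam ^ 2 *
          Real.sin_sq_add_cos_sq (k j 0 * x 0 + k j 1 * x 1 - ω j * t + δ j)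
  simp only [hvel, hpres]
  intro t _ x
  set D : Fin 3 → Fin 3 → ℝ := fun d i => waveSumDeriv k ω δ (A i) (B i) t d x with hD
  set DΨ : Fin 3 → ℝ := fun d => waveSumDeriv k ω δ 0 α t d x with hDΨ
  have hD2 (i : Fin 3) : D 2 i = 0 := by simp [hD, waveSumDeriv, waveSum]
  have hDΨ0 : DΨ 0 = -V 1 t x := by
    simp [hDΨ, hV, hA, hB, waveSumDeriv, waveSum]
  have hDΨ1 : DΨ 1 = V 0 t x := by
    simp [hDΨ, hV, hA, hB, waveSumDeriv, waveSum]
  have hDΨ2 : DΨ 2 = 0 := by simp [hDΨ, waveSumDeriv, waveSum]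
  have hDV2 (d : Fin 3) : D d 2 = γ * DΨ d := by
    simp only [hD, hDΨ, hA, hB, waveSumDeriv, waveSum, mul_sum]
    refine sum_congr rfl fun j _ => ?_
    simp
    ring
  have hdiv : D 0 0 + D 1 1 = 0 := by
    simp only [hD, hA, hB, waveSumDeriv, waveSum, ← sum_add_distrib]
    refine sum_eq_zero fun j _ => ?_
    simp
    ring
  have hcurl : D 0 1 - D 1 0 = lam ^ 2 * Ψ t x := by
    simp only [hD, hΨ, hA, hB, waveSumDeriv, waveSum, ← sum_sub_distrib, mul_sum]
    refine sum_congr rfl fun j _ => ?_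
    rw [← hk j]
    simp
    ring
  have hpd (d i : Fin 3) (E C : ℝ) : pd (fun y => E * V i t y + C) d x = E * D d i :=
    pd_affine_waveSum ..
  refine ⟨fun i => ?_, ?_⟩
  · have hdt : deriv (fun s => Real.exp (-ν * lam ^ 2 * s) * V i s x + c i) t
        = -ν * lam ^ 2 * (Real.exp (-ν * lam ^ 2 * t) * V i t x)
          - Real.exp (-ν * lam ^ 2 * t) * ∑ d, c d * D d i := by
      have h := ((((hasDerivAt_id t).const_mul (-ν * lam ^ 2)).exp).mul
        (hasDerivAt_waveSum k ω δ (A i) (B i) t x c hω)).add_const (c i)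
      refine h.deriv.trans ?_
      simp only [hV, hD, id]
      ring
    have hlap : lap (fun y => Real.exp (-ν * lam ^ 2 * t) * V i t y + c i) x
        = -(lam ^ 2 * (Real.exp (-ν * lam ^ 2 * t) * V i t x)) :=
      lap_affine_waveSum k ω δ _ _ t x hk _ _
    have hgrad : pd (fun y => ptil t - ρ₀ * Real.exp (-2 * ν * lam ^ 2 * t) *
          ((V 0 t y ^ 2 + V 1 t y ^ 2 + lam ^ 2 * Ψ t y ^ 2 - ∑ j, α j ^ 2 * lam ^ 2) / 2)) i x
        = -(ρ₀ * Real.exp (-2 * ν * lam ^ 2 * t)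
          * (V 0 t x * D i 0 + V 1 t x * D i 1 + lam ^ 2 * Ψ t x * DΨ i)) := by
      have hV' (d : Fin 3) := (differentiable_waveSum k ω δ (A d) (B d) t x).hasFDerivAt
      have hΨ' := (differentiable_waveSum k ω δ 0 α t x).hasFDerivAt
      have h := ((((((hV' 0).pow 2).add ((hV' 1).pow 2)).add
        ((hΨ'.pow 2).const_mul (lam ^ 2))).sub_const (∑ j, α j ^ 2 * lam ^ 2)).mul_const
          (2⁻¹ : ℝ)).const_mul (ρ₀ * Real.exp (-2 * ν * lam ^ 2 * t)) |>.const_sub (ptil t)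
      have h' := congrArg (fun L => L (Pi.single i 1)) h.fderiv
      refine h'.trans ?_
      simp only [hD, hDΨ, ← pd_waveSum]
      simp only [pd]
      simp [hV, hΨ]
      ring
    have hexp : Real.exp (-2 * ν * lam ^ 2 * t) = Real.exp (-ν * lam ^ 2 * t) ^ 2 := by
      rw [← Real.exp_nat_mul]
      congr 1
      push_cast
      ring
    rw [hdt, hlap, hgrad, hexp]
    simp only [adv, hpd, Fin.sum_univ_three, hD2]
    have hρ' : ρ₀ ≠ 0 := hρ.ne'
    field_simp
    fin_cases i
    all_goals simp only [Fin.zero_eta, Fin.mk_one, Fin.reduceFinMk, hD2, hDV2, hDΨ0, hDΨ1, hDΨ2]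
    · linear_combination -Real.exp (-(ν * lam ^ 2 * t)) * V 1 t x * hcurl
    · linear_combination Real.exp (-(ν * lam ^ 2 * t)) * V 0 t x * hcurl
    · ring
  · simp only [vdiv, hpd, Fin.sum_univ_three, hD2]
    linear_combination Real.exp (-ν * lam ^ 2 * t) * hdiv
end
end
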